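/- arXiv:2006.06774 — 2 statements merged into one kernel-verified Lean document; each statement's English description precedes it below -/
import Mathlib

section
/- Let Σ_A ⊆ Σ be an aperiodic and irreducible subshift of finite type and let f : Γ_A → ℝ^d be continuous. Then for every 𝐰 ∈ Ω and every α ∈ ℝ^d, h_top(E_𝐰(α)) ≤ inf_{p∈ℝ^d} P(⟨p, f − α⟩, 𝐰), where ⟨·,·⟩ is the standard inner product on ℝ^d. -/
open Filter Set
open scoped ENNReal

/-- The left shift on one-sided sequence spaces. -/
def shift {α : Type*} (x : ℕ → α) : ℕ → α := fun n => x (n + 1)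

/-- The cylinder set determined by a finite word `w`. -/
def cyl {α : Type*} {n : ℕ} (w : Fin n → α) : Set (ℕ → α) :=
  {x | ∀ k : Fin n, x (k : ℕ) = w k}

/-- Finite words over `α`, encoded with their length. -/
def Word (α : Type*) : Type _ := Σ n : ℕ, Fin n → α

/-- The length (level) of a word/cylinder. -/
def Word.len {α : Type*} (w : Word α) : ℕ := w.1

/-- The cylinder set of a word. -/
def Word.cylSet {α : Type*} (w : Word α) : Set (ℕ → α) := cyl w.2

/-- `H^s_r(E)`: infimum over covers of `E` by cylinders of level `> r` of
`∑ e^{-s·l(C)}`. -/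
noncomputable def Hsr {α : Type*} (E : Set (ℕ → α)) (s : ℝ) (r : ℕ) : ℝ≥0∞ :=
  ⨅ (S : Set (Word α)) (_ : ∀ w ∈ S, r < w.len) (_ : E ⊆ ⋃ w ∈ S, w.cylSet),
    ∑' w : S, ENNReal.ofReal (Real.exp (-s * ((w : Word α).len : ℝ)))

/-- `H^s(E) = lim_{r→∞} H^s_r(E)` (the quantities are nondecreasing in `r`). -/
noncomputable def Hentm {α : Type*} (E : Set (ℕ → α)) (s : ℝ) : ℝ≥0∞ :=
  ⨆ r : ℕ, Hsr E s r

open scoped Classical in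
/-- Topological entropy of `E ⊆ Σ`, with the convention `htop ∅ = -∞`. -/
noncomputable def htop {α : Type*} (E : Set (ℕ → α)) : EReal :=
  if E = ∅ then ⊥ else ((sInf {s : ℝ | 0 ≤ s ∧ Hentm E s ≠ ⊤} : ℝ) : EReal)

/-- The subshift of finite type determined by the 0-1 (Boolean) matrix `M`. -/
def SigmaA {K : ℕ} (M : Fin K → Fin K → Bool) : Set (ℕ → Fin K) :=
  {x | ∀ k : ℕ, M (x k) (x (k + 1)) = true}

/-- `Σ_A` is aperiodic and irreducible: some power of the adjacency matrix is
strictly positive, i.e. there is `r ≥ 1` such that any two symbols are joined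
by an admissible path of length `r`. -/
def ApIrr {K : ℕ} (M : Fin K → Fin K → Bool) : Prop :=
  ∃ r : ℕ, 0 < r ∧ ∀ i j : Fin K, ∃ p : ℕ → Fin K, p 0 = i ∧ p r = j ∧
    ∀ k < r, M (p k) (p (k + 1)) = true

/-- The (non-autonomous) Birkhoff average `(1/n) ∑_{k<n} φ_k(σ^k x)`. -/
noncomputable def birk {K : ℕ} (φ : ℕ → (ℕ → Fin K) → ℝ) (n : ℕ) (x : ℕ → Fin K) : ℝ :=
  (∑ k ∈ Finset.range n, φ k (shift^[k] x)) / n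

/-- The sequence of potentials `φ` has uniformly decreasing variations on `Σ_A`:
`ρ_n := sup_i sup_{|𝐢|=n} sup_{𝐣,𝐤 ∈ [𝐢]} |φ_i(𝐣) - φ_i(𝐤)| → 0`. -/
def UDV {K : ℕ} (M : Fin K → Fin K → Bool) (φ : ℕ → (ℕ → Fin K) → ℝ) : Prop :=
  ∀ ε > (0 : ℝ), ∃ N : ℕ, ∀ n ≥ N, ∀ i : ℕ, ∀ x ∈ SigmaA M, ∀ y ∈ SigmaA M,
    (∀ k < n, x k = y k) → |φ i x - φ i y| < ε

/-- `L_A(α,β)`: points of `Σ_A` with lower Birkhoff average `α` and upper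
Birkhoff average `β`. -/
def LAb {K : ℕ} (M : Fin K → Fin K → Bool) (φ : ℕ → (ℕ → Fin K) → ℝ) (a b : ℝ) :
    Set (ℕ → Fin K) :=
  {x | x ∈ SigmaA M ∧ Filter.liminf (fun n => birk φ n x) Filter.atTop = a ∧
    Filter.limsup (fun n => birk φ n x) Filter.atTop = b}

/-- `L_A(α) = L_A(α,α)`. -/
def LA {K : ℕ} (M : Fin K → Fin K → Bool) (φ : ℕ → (ℕ → Fin K) → ℝ) (a : ℝ) :
    Set (ℕ → Fin K) := LAb M φ a a

open MeasureTheory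

/-- The product space `Γ = Ω × Σ`. -/
abbrev GaSp (N K : ℕ) := (ℕ → Fin N) × (ℕ → Fin K)

/-- The simultaneous left shift on `Γ`. -/
def shift2 {N K : ℕ} (p : GaSp N K) : GaSp N K := (shift p.1, shift p.2)

/-- Cylinder in `Γ` given by a pair of words of equal length. -/
def cylP {N K : ℕ} {n : ℕ} (w : Fin n → Fin N) (v : Fin n → Fin K) : Set (GaSp N K) :=
  {p | (∀ k : Fin n, p.1 (k : ℕ) = w k) ∧ (∀ k : Fin n, p.2 (k : ℕ) = v k)}

/-- Cylinder determined by a `List` word (used for concatenations). -/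
def cylL {α : Type*} (w : List α) : Set (ℕ → α) :=
  {x | ∀ (k : ℕ) (h : k < w.length), x k = w.get ⟨k, h⟩}

/-- `ν` is quasi-Bernoulli. -/
def QuasiBernoulli {N : ℕ} (ν : Measure (ℕ → Fin N)) : Prop :=
  ∃ C : ℝ≥0∞, 0 < C ∧ C ≠ ⊤ ∧ ∀ w z : List (Fin N),
    C⁻¹ * (ν (cylL w) * ν (cylL z)) ≤ ν (cylL (w ++ z)) ∧
    ν (cylL (w ++ z)) ≤ C * (ν (cylL w) * ν (cylL z))

/-- Birkhoff sums `S_n g` on `Γ`. -/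
noncomputable def SnS {N K : ℕ} (g : GaSp N K → ℝ) (n : ℕ) (p : GaSp N K) : ℝ :=
  ∑ k ∈ Finset.range n, g (shift2^[k] p)

/-- The fiberwise partition function
`Z_n(g,𝐰) = Σ_{𝐢∈Σ_{A,n}} sup_{𝐣∈[𝐢]} e^{S_n g(𝐰,𝐣)}`
(words with no admissible extension contribute `sSup ∅ = 0`). -/
noncomputable def Zn {N K : ℕ} (M : Fin K → Fin K → Bool) (g : GaSp N K → ℝ)
    (w : ℕ → Fin N) (n : ℕ) : ℝ :=
  ∑ v : Fin n → Fin K,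
    sSup ((fun j => Real.exp (SnS g n (w, j))) ''
      {j | j ∈ SigmaA M ∧ ∀ k : Fin n, j (k : ℕ) = v k})

/-- The conditional pressure `P_ν(g) = lim (1/n) ∫ log Z_n(g,𝐰) dν(𝐰)`
(realized as a `limsup`; the limit exists in the situations considered). -/
noncomputable def condPressure {N K : ℕ} (M : Fin K → Fin K → Bool)
    (ν : Measure (ℕ → Fin N)) (g : GaSp N K → ℝ) : ℝ :=
  Filter.limsup (fun n : ℕ => (∫ w, Real.log (Zn M g w n) ∂ν) / n) Filter.atTop

/-- `g : Γ_A → E` has bounded variation: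
`Σ_k max_{(𝐰,𝐢)∧(𝐳,𝐣) = k} ‖g(𝐰,𝐢) − g(𝐳,𝐣)‖ < ∞`. -/
def BddVar {N K : ℕ} {E : Type*} [NormedAddCommGroup E] (M : Fin K → Fin K → Bool)
    (g : GaSp N K → E) : Prop :=
  ∃ B : ℝ, ∀ m : ℕ,
    ∑ k ∈ Finset.range m,
      sSup {d : ℝ | ∃ p q : GaSp N K, p.2 ∈ SigmaA M ∧ q.2 ∈ SigmaA M ∧
        (∀ t < k, p.1 t = q.1 t) ∧ (∀ t < k, p.2 t = q.2 t) ∧ d = ‖g p - g q‖} ≤ B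

/-- `-x log x` (with the convention `0 · log 0 = 0`). -/
noncomputable def nlog (x : ℝ) : ℝ := -(x * Real.log x)

/-- The Kolmogorov–Sinai entropy of a shift-invariant measure on `Ω`,
computed through cylinders (realized as a `limsup`; the limit exists by
subadditivity). -/
noncomputable def entOm {N : ℕ} (ν : Measure (ℕ → Fin N)) : ℝ :=
  Filter.limsup
    (fun n : ℕ => (∑ w : Fin n → Fin N, nlog ((ν (cyl w)).toReal)) / n) Filter.atTop

/-- The Kolmogorov–Sinai entropy of a shift-invariant measure on `Γ`,
computed through cylinders. -/
noncomputable def entGa {N K : ℕ} (μ : Measure (GaSp N K)) : ℝ :=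
  Filter.limsup
    (fun n : ℕ =>
      (∑ w : Fin n → Fin N, ∑ v : Fin n → Fin K, nlog ((μ (cylP w v)).toReal)) / n)
    Filter.atTop

/-- `μ ∈ M_ν(Γ_A)`: a shift-invariant probability measure on `Γ_A` with
marginal `ν`. -/
def MemMnu {N K : ℕ} (M : Fin K → Fin K → Bool) (ν : Measure (ℕ → Fin N))
    (μ : Measure (GaSp N K)) : Prop :=
  IsProbabilityMeasure μ ∧ MeasurePreserving shift2 μ μ ∧
    μ.map Prod.fst = ν ∧ μ {p | p.2 ∈ SigmaA M} = 1

/-- The level set `E_𝐰(α)` for a vector-valued potential on `Γ_A`. -/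
def EwVec {N K d : ℕ} (M : Fin K → Fin K → Bool) (f : GaSp N K → (Fin d → ℝ))
    (w : ℕ → Fin N) (α : Fin d → ℝ) : Set (ℕ → Fin K) :=
  {j | j ∈ SigmaA M ∧
    Tendsto (fun n : ℕ => (n : ℝ)⁻¹ • ∑ k ∈ Finset.range n, f (shift2^[k] (w, j)))
      atTop (nhds α)}

/-- The conditional pressure on the fiber over `𝐰`:
`P(g,𝐰) = limsup (1/n) log Z_n(g,𝐰)`. -/
noncomputable def fiberPressure {N K : ℕ} (M : Fin K → Fin K → Bool)
    (g : GaSp N K → ℝ) (w : ℕ → Fin N) : ℝ :=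
  Filter.limsup (fun n : ℕ => Real.log (Zn M g w n) / n) Filter.atTop

theorem shift2_mem_SigmaA {N K : ℕ} {M : Fin K → Fin K → Bool} {q : GaSp N K}
    (hq : q.2 ∈ SigmaA M) (k : ℕ) : (shift2^[k] q).2 ∈ SigmaA M := by
  induction k generalizing q with
  | zero => exact hq
  | succ k ih =>
    rw [Function.iterate_succ_apply]
    exact ih fun i => hq (i + 1)

theorem isCompact_snd_mem_SigmaA {N K : ℕ} (M : Fin K → Fin K → Bool) :
    IsCompact {p : GaSp N K | p.2 ∈ SigmaA M} := by
  have hset : {p : GaSp N K | p.2 ∈ SigmaA M} =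
      ⋂ k : ℕ, {p : GaSp N K | M (p.2 k) (p.2 (k + 1)) = true} := by
    ext p
    simp [SigmaA]
  rw [hset]
  refine (isClosed_iInter fun k => ?_).isCompact
  have h : Continuous fun p : GaSp N K => M (p.2 k) (p.2 (k + 1)) := by
    have h1 : Continuous fun q : Fin K × Fin K => M q.1 q.2 := continuous_of_discreteTopology
    exact h1.comp (by fun_prop : Continuous fun p : GaSp N K => (p.2 k, p.2 (k + 1)))
  exact isClosed_eq h continuous_const

theorem SnS_le_of_le {N K : ℕ} {M : Fin K → Fin K → Bool} {g : GaSp N K → ℝ} {C : ℝ}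
    (hC : ∀ q : GaSp N K, q.2 ∈ SigmaA M → g q ≤ C) (n : ℕ) {q : GaSp N K}
    (hq : q.2 ∈ SigmaA M) : SnS g n q ≤ n * C := by
  have h := Finset.sum_le_card_nsmul (Finset.range n) (fun k => g (shift2^[k] q)) C
    fun k _ => hC _ (shift2_mem_SigmaA hq k)
  simpa [SnS] using h

/-- The contribution of the word `v` to the partition function `Zn`. -/
noncomputable def wordWeight {N K : ℕ} (M : Fin K → Fin K → Bool) (g : GaSp N K → ℝ)
    (w : ℕ → Fin N) {n : ℕ} (v : Fin n → Fin K) : ℝ :=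
  sSup ((fun j => Real.exp (SnS g n (w, j))) ''
    {j | j ∈ SigmaA M ∧ ∀ k : Fin n, j (k : ℕ) = v k})

theorem Zn_eq_sum_wordWeight {N K : ℕ} (M : Fin K → Fin K → Bool) (g : GaSp N K → ℝ)
    (w : ℕ → Fin N) (n : ℕ) : Zn M g w n = ∑ v : Fin n → Fin K, wordWeight M g w v := rfl

theorem wordWeight_nonneg {N K : ℕ} (M : Fin K → Fin K → Bool) (g : GaSp N K → ℝ)
    (w : ℕ → Fin N) {n : ℕ} (v : Fin n → Fin K) : 0 ≤ wordWeight M g w v := by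
  refine Real.sSup_nonneg ?_
  rintro _ ⟨j, -, rfl⟩
  exact (Real.exp_pos _).le

theorem wordWeight_le {N K : ℕ} {M : Fin K → Fin K → Bool} {g : GaSp N K → ℝ} {C : ℝ}
    (hC : ∀ q : GaSp N K, q.2 ∈ SigmaA M → g q ≤ C) (w : ℕ → Fin N) {n : ℕ}
    (v : Fin n → Fin K) : wordWeight M g w v ≤ Real.exp (n * C) := by
  refine Real.sSup_le ?_ (Real.exp_pos _).le
  rintro _ ⟨j, hj, rfl⟩
  exact Real.exp_le_exp.2 (SnS_le_of_le hC n hj.1)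

theorem exp_SnS_le_wordWeight {N K : ℕ} {M : Fin K → Fin K → Bool} {g : GaSp N K → ℝ} {C : ℝ}
    (hC : ∀ q : GaSp N K, q.2 ∈ SigmaA M → g q ≤ C) (w : ℕ → Fin N) {n : ℕ}
    {v : Fin n → Fin K} {j : ℕ → Fin K} (hj : j ∈ SigmaA M) (hv : j ∈ cyl v) :
    Real.exp (SnS g n (w, j)) ≤ wordWeight M g w v := by
  refine le_csSup ⟨Real.exp (n * C), ?_⟩ ⟨j, ⟨hj, hv⟩, rfl⟩
  rintro _ ⟨i, hi, rfl⟩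
  exact Real.exp_le_exp.2 (SnS_le_of_le hC n hi.1)

theorem exp_SnS_le_Zn {N K : ℕ} {M : Fin K → Fin K → Bool} {g : GaSp N K → ℝ} {C : ℝ}
    (hC : ∀ q : GaSp N K, q.2 ∈ SigmaA M → g q ≤ C) (w : ℕ → Fin N) (n : ℕ)
    {j : ℕ → Fin K} (hj : j ∈ SigmaA M) : Real.exp (SnS g n (w, j)) ≤ Zn M g w n :=
  (exp_SnS_le_wordWeight hC w (v := fun k : Fin n => j k) hj fun _ => rfl).trans <|
    Finset.single_le_sum (f := fun v : Fin n → Fin K => wordWeight M g w v)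
      (fun v _ => wordWeight_nonneg M g w v) (Finset.mem_univ _)

theorem Zn_le {N K : ℕ} {M : Fin K → Fin K → Bool} {g : GaSp N K → ℝ} {C : ℝ}
    (hC : ∀ q : GaSp N K, q.2 ∈ SigmaA M → g q ≤ C) (w : ℕ → Fin N) (n : ℕ) :
    Zn M g w n ≤ (K : ℝ) ^ n * Real.exp (n * C) := by
  rw [Zn_eq_sum_wordWeight]
  refine (Finset.sum_le_card_nsmul _ _ _ fun v _ => wordWeight_le hC w v).trans_eq ?_
  simp

theorem isBoundedUnder_log_Zn_div {N K : ℕ} {M : Fin K → Fin K → Bool} {g : GaSp N K → ℝ} {C : ℝ}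
    (hC : ∀ q : GaSp N K, q.2 ∈ SigmaA M → g q ≤ C) (w : ℕ → Fin N)
    (hne : (SigmaA M).Nonempty) :
    IsBoundedUnder (· ≤ ·) atTop fun n : ℕ => Real.log (Zn M g w n) / n := by
  obtain ⟨j, hj⟩ := hne
  have hK : (0 : ℝ) < K := by exact_mod_cast (j 0).pos
  refine isBoundedUnder_of_eventually_le (a := Real.log K + C) ?_
  filter_upwards [eventually_gt_atTop 0] with n hn
  have hn' : (0 : ℝ) < n := by exact_mod_cast hn
  rw [div_le_iff₀ hn']
  have h := Real.log_le_log ((Real.exp_pos _).trans_le (exp_SnS_le_Zn hC w n hj)) (Zn_le hC w n)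
  rw [Real.log_mul (by positivity) (Real.exp_pos _).ne', Real.log_pow, Real.log_exp] at h
  linarith

/-- If the Birkhoff averages of `g` along one point of the fiber tend to `0`, then the fiber
pressure of `g` is nonnegative. -/
theorem fiberPressure_nonneg {N K : ℕ} {M : Fin K → Fin K → Bool} {g : GaSp N K → ℝ} {C : ℝ}
    (hC : ∀ q : GaSp N K, q.2 ∈ SigmaA M → g q ≤ C) (w : ℕ → Fin N) {j : ℕ → Fin K}
    (hj : j ∈ SigmaA M) (hlim : Tendsto (fun n : ℕ => SnS g n (w, j) / n) atTop (nhds 0)) :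
    0 ≤ fiberPressure M g w := by
  refine le_of_forall_lt fun c hc => ?_
  obtain ⟨b, hcb, hb⟩ := exists_between hc
  refine hcb.trans_le (le_limsup_of_frequently_le (Eventually.frequently ?_)
    (isBoundedUnder_log_Zn_div hC w ⟨j, hj⟩))
  filter_upwards [hlim.eventually (lt_mem_nhds hb)] with n hn
  refine hn.le.trans ?_
  gcongr
  exact (Real.le_log_iff_exp_le ((Real.exp_pos _).trans_le (exp_SnS_le_Zn hC w n hj))).2
    (exp_SnS_le_Zn hC w n hj)

theorem Hentm_ne_top_of_fiberPressure_lt {N K : ℕ} {M : Fin K → Fin K → Bool}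
    {g : GaSp N K → ℝ} {C : ℝ}
    (hC : ∀ q : GaSp N K, q.2 ∈ SigmaA M → g q ≤ C) (w : ℕ → Fin N) {E : Set (ℕ → Fin K)}
    (hE : ∀ j ∈ E, j ∈ SigmaA M ∧ Tendsto (fun n : ℕ => SnS g n (w, j) / n) atTop (nhds 0))
    (hne : E.Nonempty) {s : ℝ} (hs : fiberPressure M g w < s) : Hentm E s ≠ ⊤ := by
  classical
  obtain ⟨j₀, hj₀⟩ := hne
  have hj₀ := (hE j₀ hj₀).1
  obtain ⟨ε, hε, hεs⟩ : ∃ ε > 0, fiberPressure M g w + 3 * ε = s :=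
    ⟨(s - fiberPressure M g w) / 3, by linarith, by ring⟩
  have hlt : fiberPressure M g w < s - 2 * ε := by linarith
  obtain ⟨m, hm⟩ := eventually_atTop.1
    (eventually_lt_of_limsup_lt hlt (isBoundedUnder_log_Zn_div hC w ⟨j₀, hj₀⟩))
  have hZ : ∀ n : ℕ, m < n → Zn M g w n ≤ Real.exp ((s - 2 * ε) * n) := fun n hn => by
    have hn' : (0 : ℝ) < n := by exact_mod_cast (Nat.zero_le m).trans_lt hn
    have h := (div_lt_iff₀ hn').1 (hm n hn.le)
    exact ((Real.log_lt_iff_lt_exp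
      ((Real.exp_pos _).trans_le (exp_SnS_le_Zn hC w n hj₀))).1 h).le
  have hsum : Summable fun n : ℕ => Real.exp (n * (-ε)) :=
    Real.summable_exp_nat_mul_iff.2 (by linarith)
  refine ne_top_of_le_ne_top hsum.tsum_ofReal_ne_top (iSup_le fun r => ?_)
  let S : Set (Word (Fin K)) := {v | max r m < v.len ∧
    ∃ j ∈ SigmaA M, j ∈ v.cylSet ∧ -(ε * v.len) ≤ SnS g v.len (w, j)}
  have hcover : E ⊆ ⋃ v ∈ S, v.cylSet := fun j hj => by
    obtain ⟨hjM, hjlim⟩ := hE j hj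
    obtain ⟨n, hn, hnr⟩ := ((hjlim.eventually (lt_mem_nhds (neg_lt_zero.2 hε))).and
      (eventually_gt_atTop (max r m))).exists
    have hn' : (0 : ℝ) < n := by exact_mod_cast (Nat.zero_le _).trans_lt hnr
    refine mem_biUnion (x := (⟨n, fun k => j k⟩ : Word (Fin K)))
      ⟨hnr, j, hjM, fun _ => rfl, ?_⟩ fun _ => rfl
    have h := ((lt_div_iff₀ hn').1 hn).le
    simpa [Word.len] using h
  refine (iInf_le_of_le S (iInf₂_le_of_le (fun v hv => (le_max_left _ _).trans_lt hv.1) hcover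
    le_rfl)).trans ?_
  rw [tsum_subtype S fun v => ENNReal.ofReal (Real.exp (-s * (v.len : ℝ)))]
  refine (ENNReal.tsum_sigma' (β := fun n => Fin n → Fin K) _).trans_le
    (ENNReal.tsum_le_tsum fun n => ?_)
  rw [tsum_fintype]
  rcases le_or_gt n m with hnm | hnm
  · refine (Finset.sum_eq_zero fun v _ => indicator_of_notMem ?_ _).trans_le zero_le
    exact fun hv => absurd ((le_max_right r m).trans_lt hv.1) hnm.not_gt
  have hword : ∀ v : Fin n → Fin K,
      S.indicator (fun v => ENNReal.ofReal (Real.exp (-s * (v.len : ℝ)))) ⟨n, v⟩ ≤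
        ENNReal.ofReal (Real.exp ((ε - s) * n) * wordWeight M g w v) := fun v => by
    refine indicator_apply_le' (fun hv => ENNReal.ofReal_le_ofReal ?_) fun _ => zero_le
    obtain ⟨-, j, hjM, hjv, hjS⟩ := hv
    refine le_trans ?_ (mul_le_mul_of_nonneg_left
      (exp_SnS_le_wordWeight hC w hjM hjv) (Real.exp_pos _).le)
    rw [← Real.exp_add, Real.exp_le_exp]
    simp only [Word.len] at hjS ⊢
    linarith
  refine (Finset.sum_le_sum fun v _ => hword v).trans ?_
  rw [← ENNReal.ofReal_sum_of_nonneg fun v _ =>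
    mul_nonneg (Real.exp_pos _).le (wordWeight_nonneg M g w v), ← Finset.mul_sum,
    ← Zn_eq_sum_wordWeight]
  refine ENNReal.ofReal_le_ofReal ((mul_le_mul_of_nonneg_left (hZ n hnm)
    (Real.exp_pos _).le).trans_eq ?_)
  rw [← Real.exp_add]
  ring_nf

theorem htop_le_fiberPressure {N K : ℕ} {M : Fin K → Fin K → Bool}
    {g : GaSp N K → ℝ} {C : ℝ}
    (hC : ∀ q : GaSp N K, q.2 ∈ SigmaA M → g q ≤ C) (w : ℕ → Fin N) {E : Set (ℕ → Fin K)}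
    (hE : ∀ j ∈ E, j ∈ SigmaA M ∧ Tendsto (fun n : ℕ => SnS g n (w, j) / n) atTop (nhds 0)) :
    htop E ≤ ((fiberPressure M g w : ℝ) : EReal) := by
  rcases E.eq_empty_or_nonempty with rfl | hne
  · simp [htop]
  rw [htop, if_neg hne.ne_empty, EReal.coe_le_coe_iff]
  obtain ⟨j, hj⟩ := hne
  have h0 := fiberPressure_nonneg hC w (hE j hj).1 (hE j hj).2
  refine le_of_forall_gt_imp_ge_of_dense fun s hs => csInf_le ⟨0, fun t ht => ht.1⟩ ?_
  exact ⟨h0.trans hs.le, Hentm_ne_top_of_fiberPressure_lt hC w hE ⟨j, hj⟩ hs⟩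

theorem tendsto_SnS_div_of_mem_EwVec {N K d : ℕ} {M : Fin K → Fin K → Bool}
    {f : GaSp N K → (Fin d → ℝ)} {w : ℕ → Fin N} {α : Fin d → ℝ} (p : Fin d → ℝ)
    {j : ℕ → Fin K} (hj : j ∈ EwVec M f w α) :
    Tendsto (fun n : ℕ => SnS (fun q => ∑ t, p t * (f q t - α t)) n (w, j) / n)
      atTop (nhds 0) := by
  have h : Tendsto (fun n : ℕ => ∑ t, p t *
      (((n : ℝ)⁻¹ • ∑ k ∈ Finset.range n, f (shift2^[k] (w, j))) t - α t)) atTop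
      (nhds (∑ t, p t * (α t - α t))) :=
    tendsto_finsetSum _ fun t _ => ((tendsto_pi_nhds.1 hj.2 t).sub_const _).const_mul _
  simp only [sub_self, mul_zero, Finset.sum_const_zero] at h
  refine h.congr' ?_
  filter_upwards [eventually_gt_atTop 0] with n hn
  have hn' : (n : ℝ) ≠ 0 := by exact_mod_cast hn.ne'
  rw [SnS, Finset.sum_comm, Finset.sum_div]
  refine Finset.sum_congr rfl fun t _ => ?_
  rw [← Finset.mul_sum, Finset.sum_sub_distrib, Finset.sum_const, Finset.card_range, nsmul_eq_mul,
    Pi.smul_apply, Finset.sum_apply, smul_eq_mul]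
  field_simp

theorem entropy_upper_bound_by_fiber_pressure
    {N K d : ℕ} (M : Fin K → Fin K → Bool) (hA : ApIrr M)
    (f : GaSp N K → (Fin d → ℝ)) (hf : ContinuousOn f {p : GaSp N K | p.2 ∈ SigmaA M}) :
    ∀ (w : ℕ → Fin N) (α : Fin d → ℝ),
      htop (EwVec M f w α) ≤
        ⨅ p : Fin d → ℝ,
          ((fiberPressure M (fun gq => ∑ t, p t * (f gq t - α t)) w : ℝ) : EReal) := by
  intro w α
  refine le_iInf fun p => ?_
  have hg : ContinuousOn (fun q => ∑ t, p t * (f q t - α t))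
      {q : GaSp N K | q.2 ∈ SigmaA M} := by
    have hft := continuousOn_pi.1 hf
    fun_prop
  obtain ⟨C, hC⟩ := (isCompact_snd_mem_SigmaA M).bddAbove_image hg
  exact htop_le_fiberPressure (fun q hq => hC ⟨q, hq, rfl⟩) w
    fun j hj => ⟨hj.1, tendsto_SnS_div_of_mem_EwVec p hj⟩
end

section
/- Let q = (q_1,…,q_N) be a probability vector and let 𝐰, 𝐰′ ∈ {1,…,N}^ℕ both be q-frequency regular with the same frequency vector q. Then for any real numbers (f_{j,i}) (1 ≤ j ≤ N, 1 ≤ i ≤ K) and every α ∈ ℝ, h_top(E_𝐰(α)) = h_top(E_{𝐰′}(α)). -/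
open Filter Set
open scoped ENNReal

/-- `q` is a probability vector. -/
def ProbVec {N : ℕ} (q : Fin N → ℝ) : Prop :=
  (∀ j, 0 ≤ q j) ∧ ∑ j, q j = 1

/-- `𝐰` is `q`-frequency regular: every symbol `j` occurs with asymptotic
frequency `q j`. -/
def FreqReg {N : ℕ} (w : ℕ → Fin N) (q : Fin N → ℝ) : Prop :=
  ∀ j : Fin N, Tendsto
    (fun n : ℕ => (((Finset.range (n + 1)).filter (fun k => w k = j)).card : ℝ) / n)
    atTop (nhds (q j))

/-- The level set `E_𝐰(α)` of the weighted Birkhoff average determined by the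
values `f j i` (potential depending on the first coordinates). -/
def EwSet {N K : ℕ} (f : Fin N → Fin K → ℝ) (w : ℕ → Fin N) (α : ℝ) :
    Set (ℕ → Fin K) :=
  {x | Tendsto (fun n : ℕ => (∑ k ∈ Finset.range n, f (w k) (x k)) / n) atTop (nhds α)}

/-- The word formed by the first `n` coordinates of a sequence. -/
def initialWord {α : Type*} (n : ℕ) (x : ℕ → α) : Fin n → α := fun k => x k

theorem Hsr_mono {α : Type*} (E : Set (ℕ → α)) (s : ℝ) : Monotone (Hsr E s) := by
  intro r r' hr
  refine le_iInf fun S => le_iInf fun hS => le_iInf fun hE => ?_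
  exact iInf_le_of_le S (iInf_le_of_le (fun w hw => hr.trans_lt (hS w hw)) (iInf_le _ hE))

/-- The words of the same length as `u` seen by sequences whose image under `Φ` lies in the
cylinder of `u`. -/
def preimageWords {α : Type*} (Φ : (ℕ → α) → ℕ → α) (u : Word α) : Set (Word α) :=
  (fun v : Fin u.1 → α => (⟨u.1, v⟩ : Word α)) '' (initialWord u.1 '' (Φ ⁻¹' u.cylSet))

theorem encard_preimageWords_le {α : Type*} [Finite α] (Φ : (ℕ → α) → ℕ → α) (u : Word α) :
    (preimageWords Φ u).encard ≤ (initialWord u.len '' (Φ ⁻¹' u.cylSet)).ncard :=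
  (encard_image_le _ _).trans_eq (Set.toFinite _).cast_ncard_eq.symm

theorem Hsr_le_of_mapsTo {K : ℕ} {E E' : Set (ℕ → Fin K)} {Φ : (ℕ → Fin K) → ℕ → Fin K}
    (hΦ : MapsTo Φ E' E) {s t : ℝ} {r : ℕ}
    (hcount : ∀ n > r, ∀ u : Fin n → Fin K,
      ((initialWord n '' (Φ ⁻¹' cyl u)).ncard : ℝ) * Real.exp (-t * n) ≤ Real.exp (-s * n)) :
    Hsr E' t r ≤ Hsr E s r := by
  refine le_iInf fun S => le_iInf fun hS => le_iInf fun hE => ?_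
  refine iInf_le_of_le (⋃ u ∈ S, preimageWords Φ u) (iInf_le_of_le ?_ (iInf_le_of_le ?_ ?_))
  · intro v hv
    obtain ⟨u, hu, hv⟩ := mem_iUnion₂.1 hv
    obtain ⟨_, _, rfl⟩ := hv
    exact hS u hu
  · intro x hx
    obtain ⟨u, hu, hxu⟩ := mem_iUnion₂.1 (hE (hΦ hx))
    exact mem_iUnion₂.2 ⟨⟨u.1, initialWord u.1 x⟩,
      mem_iUnion₂.2 ⟨u, hu, _, ⟨x, hxu, rfl⟩, rfl⟩, fun _ => rfl⟩
  · refine (ENNReal.tsum_biUnion_le_tsum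
      (fun v : Word (Fin K) => ENNReal.ofReal (Real.exp (-t * (v.len : ℝ)))) S
      (preimageWords Φ)).trans (ENNReal.tsum_le_tsum fun u => ?_)
    have hlen : ∀ v : preimageWords Φ u.1, (v : Word (Fin K)).len = u.1.len := by
      rintro ⟨_, _, _, rfl⟩
      rfl
    simp only [hlen]
    rw [ENNReal.tsum_const, ENat.card_coe_set_eq]
    refine (mul_le_mul_left (ENat.toENNReal_le.2 (encard_preimageWords_le Φ u.1)) _).trans ?_
    rw [ENat.toENNReal_coe, ← ENNReal.ofReal_natCast, ← ENNReal.ofReal_mul (Nat.cast_nonneg _)]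
    exact ENNReal.ofReal_le_ofReal (hcount _ (hS _ u.2) _)

theorem Hentm_ne_top_of_mapsTo {K : ℕ} (hK : 0 < K) {E E' : Set (ℕ → Fin K)}
    {Φ : (ℕ → Fin K) → ℕ → Fin K} (hΦ : MapsTo Φ E' E) {b : ℕ → ℕ}
    (hb : Tendsto (fun n => (b n : ℝ) / n) atTop (nhds 0))
    (hcount : ∀ n (u : Fin n → Fin K), (initialWord n '' (Φ ⁻¹' cyl u)).ncard ≤ K ^ b n)
    {s t : ℝ} (hst : s < t) (hs : Hentm E s ≠ ⊤) : Hentm E' t ≠ ⊤ := by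
  have hlim : Tendsto (fun n => (b n : ℝ) / n * Real.log K) atTop (nhds 0) := by
    simpa using hb.mul_const (Real.log K)
  obtain ⟨r₀, hr₀⟩ := eventually_atTop.1 (hlim.eventually_lt_const (sub_pos.2 hst))
  refine ne_top_of_le_ne_top hs (iSup_le fun r => ?_)
  refine (Hsr_mono E' t (le_max_left r r₀)).trans
    (le_trans (Hsr_le_of_mapsTo hΦ fun n hn u => ?_) (le_iSup (Hsr E s) (max r r₀)))
  have hnr : r₀ < n := (le_max_right _ _).trans_lt hn
  have hn0 : (0 : ℝ) < n := by exact_mod_cast (Nat.zero_le _).trans_lt hnr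
  have hbn : (b n : ℝ) * Real.log K ≤ (t - s) * n := by
    have := hr₀ n hnr.le
    rw [div_mul_eq_mul_div, div_lt_iff₀ hn0] at this
    exact this.le
  calc ((initialWord n '' (Φ ⁻¹' cyl u)).ncard : ℝ) * Real.exp (-t * n)
      ≤ (K : ℝ) ^ b n * Real.exp (-t * n) := by
        gcongr
        exact_mod_cast hcount n u
    _ = Real.exp (b n * Real.log K + -t * n) := by
        rw [Real.exp_add, Real.exp_nat_mul, Real.exp_log (by exact_mod_cast hK)]
    _ ≤ Real.exp (-s * n) := Real.exp_le_exp.2 (by linarith)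

/-- Sends the `m`-th occurrence of a symbol in `w` to the `m`-th occurrence of the same symbol
in `w'` (when there is one). -/
noncomputable def matchIndex {N : ℕ} (w w' : ℕ → Fin N) (p : ℕ) : ℕ :=
  Nat.nth (fun k => w' k = w p) (Nat.count (fun k => w k = w p) p)

/-- The positions `p < n` of `w` that are matched with a position `< n` of `w'`. -/
def matched {N : ℕ} (w w' : ℕ → Fin N) (n : ℕ) : Finset ℕ :=
  (Finset.range n).filter fun p =>
    Nat.count (fun k => w k = w p) p < Nat.count (fun k => w' k = w p) n

section matching

variable {N : ℕ} {w w' : ℕ → Fin N} {n : ℕ}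

theorem matched_subset_range : matched w w' n ⊆ Finset.range n := Finset.filter_subset _ _

theorem symbol_matchIndex {p : ℕ} (hp : p ∈ matched w w' n) : w' (matchIndex w w' p) = w p :=
  Nat.nth_mem (p := fun k => w' k = w p) _ fun hf =>
    (Finset.mem_filter.1 hp).2.trans_le (Nat.count_le_card hf n)

theorem matchIndex_lt {p : ℕ} (hp : p ∈ matched w w' n) : matchIndex w w' p < n :=
  Nat.nth_lt_of_lt_count (Finset.mem_filter.1 hp).2

theorem matchIndex_injOn : InjOn (matchIndex w w') (matched w w' n) := by
  intro p hp p' hp' h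
  have hw : w p = w p' := by rw [← symbol_matchIndex hp, ← symbol_matchIndex hp', h]
  have hc : ∀ {p}, p ∈ matched w w' n → ∀ hf : (Set.ofPred fun k => w' k = w p).Finite,
      Nat.count (fun k => w k = w p) p < hf.toFinset.card := fun hp hf =>
    (Finset.mem_filter.1 hp).2.trans_le (Nat.count_le_card hf n)
  have h₁ := hc hp
  have h₂ := hc hp'
  unfold matchIndex at h
  rw [← hw] at h h₂
  have hcount := congrArg (Nat.count fun k => w' k = w p) h
  rw [Nat.count_nth h₁, Nat.count_nth h₂] at hcount
  exact Nat.count_injective (p := fun k => w k = w p) rfl hw.symm hcount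

theorem image_matchIndex_subset_range :
    (matched w w' n).image (matchIndex w w') ⊆ Finset.range n :=
  Finset.image_subset_iff.2 fun _ hp => Finset.mem_range.2 (matchIndex_lt hp)

theorem card_range_sdiff_image_matchIndex :
    (Finset.range n \ (matched w w' n).image (matchIndex w w')).card =
      (Finset.range n \ matched w w' n).card := by
  rw [Finset.card_sdiff_of_subset image_matchIndex_subset_range,
    Finset.card_sdiff_of_subset matched_subset_range, Finset.card_image_of_injOn matchIndex_injOn]

theorem card_unmatched_le :
    (Finset.range n \ matched w w' n).card ≤
      ∑ j, (Nat.count (fun k => w k = j) n - Nat.count (fun k => w' k = j) n) := by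
  have hcard : ∀ j, Nat.count (fun k => w k = j) n - Nat.count (fun k => w' k = j) n =
      (Finset.Ico (Nat.count (fun k => w' k = j) n) (Nat.count (fun k => w k = j) n)).card :=
    fun j => (Nat.card_Ico _ _).symm
  simp only [hcard]
  rw [← Finset.card_sigma]
  refine Finset.card_le_card_of_injOn
    (fun p => ⟨w p, Nat.count (fun k => w k = w p) p⟩) ?_ ?_
  · intro p hp
    rw [Finset.mem_coe, Finset.mem_sdiff, Finset.mem_range, matched, Finset.mem_filter,
      Finset.mem_range, not_and, not_lt] at hp
    simp only [Finset.coe_sigma, mem_sigma_iff, Finset.coe_univ, mem_univ, true_and,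
      Finset.coe_Ico, mem_Ico]
    exact ⟨hp.2 hp.1, Nat.count_strict_mono (p := fun k => w k = w p) rfl hp.1⟩
  · intro p _ p' _ h
    have hw : w p = w p' := congrArg Sigma.fst h
    simp only [← hw, Sigma.mk.injEq, heq_eq_eq, true_and] at h
    exact Nat.count_injective (p := fun k => w k = w p) rfl hw.symm h

end matching

theorem FreqReg.tendsto_count {N : ℕ} {w : ℕ → Fin N} {q : Fin N → ℝ} (hw : FreqReg w q)
    (j : Fin N) :
    Tendsto (fun n : ℕ => (Nat.count (fun k => w k = j) n : ℝ) / n) atTop (nhds (q j)) := by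
  rw [← tendsto_add_atTop_iff_nat 1]
  have h := (hw j).mul (tendsto_natCast_div_add_atTop (1 : ℝ))
  rw [mul_one] at h
  refine h.congr' ?_
  filter_upwards [eventually_ne_atTop 0] with n hn
  have : (n : ℝ) ≠ 0 := Nat.cast_ne_zero.2 hn
  rw [Nat.count_eq_card_filter_range]
  push_cast
  field_simp

theorem tendsto_card_unmatched_div {N : ℕ} {w w' : ℕ → Fin N} {q : Fin N → ℝ}
    (hw : FreqReg w q) (hw' : FreqReg w' q) :
    Tendsto (fun n : ℕ => ((Finset.range n \ matched w w' n).card : ℝ) / n) atTop (nhds 0) := by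
  have h : Tendsto (fun n : ℕ => ∑ j, |(Nat.count (fun k => w k = j) n : ℝ) / n -
      (Nat.count (fun k => w' k = j) n : ℝ) / n|) atTop (nhds 0) := by
    have := tendsto_finsetSum Finset.univ fun j _ =>
      ((hw.tendsto_count j).sub (hw'.tendsto_count j)).abs
    simpa using this
  refine squeeze_zero (fun n => by positivity) (fun n => ?_) h
  simp only [← sub_div, abs_div, Nat.abs_cast, ← Finset.sum_div]
  gcongr
  refine (Nat.cast_le.2 card_unmatched_le).trans ?_
  rw [Nat.cast_sum]
  refine Finset.sum_le_sum fun j _ => ?_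
  rcases le_total (Nat.count (fun k => w k = j) n) (Nat.count (fun k => w' k = j) n) with h | h
  · simp [Nat.sub_eq_zero_of_le h]
  · rw [Nat.cast_sub h]
    exact le_abs_self _

theorem ncard_initialWord_image_le {N K : ℕ} (w w' : ℕ → Fin N) (n : ℕ) (u : Fin n → Fin K) :
    (initialWord n '' ((fun x => x ∘ matchIndex w w') ⁻¹' cyl u)).ncard ≤
      K ^ (Finset.range n \ matched w w' n).card := by
  set T := Finset.range n \ (matched w w' n).image (matchIndex w w') with hT
  have hlt : ∀ k : T, (k : ℕ) < n := fun k => Finset.mem_range.1 (Finset.mem_sdiff.1 k.2).1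
  have hcard : (univ : Set (T → Fin K)).ncard = K ^ (Finset.range n \ matched w w' n).card := by
    rw [ncard_univ, Nat.card_fun, Nat.card_fin, Nat.card_eq_fintype_card, Fintype.card_coe, hT,
      card_range_sdiff_image_matchIndex]
  rw [← hcard]
  refine ncard_le_ncard_of_injOn (fun v k => v ⟨k, hlt k⟩) (fun _ _ => mem_univ _) ?_
  rintro _ ⟨x, hx, rfl⟩ _ ⟨y, hy, rfl⟩ hxy
  ext1 k
  by_cases hk : (k : ℕ) ∈ (matched w w' n).image (matchIndex w w')
  · obtain ⟨p, hp, hpk⟩ := Finset.mem_image.1 hk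
    have hpn := Finset.mem_range.1 (matched_subset_range hp)
    have := (hx ⟨p, hpn⟩).trans (hy ⟨p, hpn⟩).symm
    simpa [initialWord, hpk] using this
  · exact congrFun hxy ⟨k, Finset.mem_sdiff.2 ⟨Finset.mem_range.2 k.2, hk⟩⟩

theorem comp_matchIndex_mapsTo {N K : ℕ} {q : Fin N → ℝ} {w w' : ℕ → Fin N}
    (hw : FreqReg w q) (hw' : FreqReg w' q) (f : Fin N → Fin K → ℝ) (α : ℝ) :
    MapsTo (fun x => x ∘ matchIndex w w') (EwSet f w' α) (EwSet f w α) := by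
  intro x hx
  obtain ⟨C, hC⟩ : ∃ C : ℝ, ∀ j i, |f j i| ≤ C := by
    obtain ⟨C, hC⟩ := (finite_range fun z : Fin N × Fin K => |f z.1 z.2|).bddAbove
    exact ⟨C, fun j i => hC ⟨(j, i), rfl⟩⟩
  have hlim : Tendsto (fun n : ℕ => 2 * C * (((Finset.range n \ matched w w' n).card : ℝ) / n))
      atTop (nhds 0) := by
    simpa using (tendsto_card_unmatched_div hw hw').const_mul (2 * C)
  refine tendsto_of_tendsto_of_dist (f₁ := fun n : ℕ =>
    (∑ k ∈ Finset.range n, f (w' k) (x k)) / n) hx (squeeze_zero (fun _ => dist_nonneg) ?_ hlim)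
  intro n
  have hbound : ∀ (T : Finset ℕ) (v : ℕ → Fin N) (y : ℕ → Fin K),
      |∑ k ∈ T, f (v k) (y k)| ≤ T.card * C := fun T v y =>
    (Finset.abs_sum_le_sum_abs _ _).trans
      ((Finset.sum_le_card_nsmul _ _ C fun k _ => hC _ _).trans_eq (nsmul_eq_mul _ _))
  have hmatch : ∑ k ∈ (matched w w' n).image (matchIndex w w'), f (w' k) (x k) =
      ∑ p ∈ matched w w' n, f (w p) ((x ∘ matchIndex w w') p) := by
    rw [Finset.sum_image matchIndex_injOn]
    exact Finset.sum_congr rfl fun p hp => by rw [symbol_matchIndex hp, Function.comp_apply]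
  have h₁ := hbound (Finset.range n \ matched w w' n) w (x ∘ matchIndex w w')
  have h₂ := hbound (Finset.range n \ (matched w w' n).image (matchIndex w w')) w' x
  rw [card_range_sdiff_image_matchIndex] at h₂
  rw [Real.dist_eq, ← sub_div, abs_div, Nat.abs_cast, ← mul_div_assoc,
    ← Finset.sum_sdiff image_matchIndex_subset_range, hmatch,
    ← Finset.sum_sdiff (matched_subset_range (w := w) (w' := w')), add_sub_add_right_eq_sub]
  gcongr
  exact (abs_sub _ _).trans (by linarith)

theorem htop_EwSet_le {N K : ℕ} {q : Fin N → ℝ} {w w' : ℕ → Fin N}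
    (hw : FreqReg w q) (hw' : FreqReg w' q) (f : Fin N → Fin K → ℝ) (α : ℝ) :
    htop (EwSet f w' α) ≤ htop (EwSet f w α) := by
  rcases (EwSet f w' α).eq_empty_or_nonempty with h' | ⟨x, hx⟩
  · simp [htop, h']
  have hK : 0 < K := (Nat.zero_le _).trans_lt (x 0).2
  have hne' : EwSet f w' α ≠ ∅ := nonempty_iff_ne_empty.1 ⟨x, hx⟩
  have hne : EwSet f w α ≠ ∅ :=
    nonempty_iff_ne_empty.1 ⟨_, comp_matchIndex_mapsTo hw hw' f α hx⟩
  have key : ∀ {v v' : ℕ → Fin N}, FreqReg v q → FreqReg v' q → ∀ {s t : ℝ}, s < t →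
      Hentm (EwSet f v α) s ≠ ⊤ → Hentm (EwSet f v' α) t ≠ ⊤ := fun hv hv' =>
    Hentm_ne_top_of_mapsTo hK (comp_matchIndex_mapsTo hv hv' f α)
      (tendsto_card_unmatched_div hv hv') (ncard_initialWord_image_le _ _)
  rw [htop, htop, if_neg hne', if_neg hne, EReal.coe_le_coe_iff]
  have hbdd : BddBelow {s : ℝ | 0 ≤ s ∧ Hentm (EwSet f w' α) s ≠ ⊤} := ⟨0, fun _ hs => hs.1⟩
  rcases {s : ℝ | 0 ≤ s ∧ Hentm (EwSet f w α) s ≠ ⊤}.eq_empty_or_nonempty with h | h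
  · have : {s : ℝ | 0 ≤ s ∧ Hentm (EwSet f w' α) s ≠ ⊤} = ∅ :=
      eq_empty_of_forall_notMem fun s hs => notMem_empty (s + 1) <|
        h ▸ (⟨by linarith [hs.1], key hw' hw (lt_add_one s) hs.2⟩ :
          s + 1 ∈ {s : ℝ | 0 ≤ s ∧ Hentm (EwSet f w α) s ≠ ⊤})
    rw [h, this]
  · refine le_csInf h fun s hs => le_of_forall_pos_le_add fun ε hε => csInf_le hbdd ?_
    exact ⟨by linarith [hs.1], key hw hw' (lt_add_of_pos_right s hε) hs.2⟩

theorem spectrum_depends_only_on_frequencies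
    {N K : ℕ} (q : Fin N → ℝ) (hq : ProbVec q)
    (w w' : ℕ → Fin N) (hw : FreqReg w q) (hw' : FreqReg w' q) :
    ∀ (f : Fin N → Fin K → ℝ) (α : ℝ),
      htop (EwSet f w α) = htop (EwSet f w' α) := by
  intro f α
  exact le_antisymm (htop_EwSet_le hw' hw f α) (htop_EwSet_le hw hw' f α)
end
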